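/- Let γ be a Borel probability measure on ℝ^N × ℝ^N with marginals μ and ν. Then γ is bicausal if and only if, in the successive disintegration γ(dx₁,…,dx_N,dy₁,…,dy_N) = γ̄(dx₁,dy₁) γ^{x₁,y₁}(dx₂,dy₂) ⋯ γ^{x₁,…,x_{N−1},y₁,…,y_{N−1}}(dx_N,dy_N), one has: γ̄ ∈ Π(μ₁,ν₁) where μ₁, ν₁ are the first-coordinate marginals of μ and ν, and for every t < N and γ-almost every (x₁,…,x_t,y₁,…,y_t), the first marginal of γ^{x₁,…,x_t,y₁,…,y_t} equals μ^{x₁,…,x_t} and its second marginal equals ν^{y₁,…,y_t}. -/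

import Mathlib

open MeasureTheory ProbabilityTheory Filter
open scoped ENNReal NNReal Topology

noncomputable section

/-- `dund` is a metric on `ℝ` inducing the usual topology. -/
structure IsCompatibleMetric (dund : ℝ → ℝ → ℝ) : Prop where
  self_eq_zero : ∀ x, dund x x = 0
  eq_of_dist_eq_zero : ∀ x y, dund x y = 0 → x = y
  symm : ∀ x y, dund x y = dund y x
  triangle : ∀ x y z, dund x z ≤ dund x y + dund y z
  compatible : ∀ (x : ℝ) (u : ℕ → ℝ),
    Tendsto u atTop (nhds x) ↔ Tendsto (fun n => dund (u n) x) atTop (nhds 0)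

/-- Couplings: measures on the product with prescribed marginals. -/
def coupling {α β : Type*} [MeasurableSpace α] [MeasurableSpace β]
    (μ : Measure α) (ν : Measure β) : Set (Measure (α × β)) :=
  {γ | γ.map Prod.fst = μ ∧ γ.map Prod.snd = ν}

/-- Projection onto the first `t` coordinates. -/
def proj (N t : ℕ) (ht : t ≤ N) (x : Fin N → ℝ) : Fin t → ℝ :=
  fun i => x (Fin.castLE ht i)

/-- The σ-algebra generated by the first `t` coordinates of the first (`x`) component. -/
def sigmaX (N t : ℕ) (ht : t ≤ N) : MeasurableSpace ((Fin N → ℝ) × (Fin N → ℝ)) :=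
  MeasurableSpace.comap (fun z => proj N t ht z.1) inferInstance

/-- The σ-algebra generated by the first `t` coordinates of the second (`y`) component. -/
def sigmaY (N t : ℕ) (ht : t ≤ N) : MeasurableSpace ((Fin N → ℝ) × (Fin N → ℝ)) :=
  MeasurableSpace.comap (fun z => proj N t ht z.2) inferInstance

/-- The σ-algebra generated by all coordinates of the first (`x`) component. -/
def sigmaXfull (N : ℕ) : MeasurableSpace ((Fin N → ℝ) × (Fin N → ℝ)) :=
  MeasurableSpace.comap Prod.fst inferInstance

/-- The σ-algebra generated by all coordinates of the second (`y`) component. -/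
def sigmaYfull (N : ℕ) : MeasurableSpace ((Fin N → ℝ) × (Fin N → ℝ)) :=
  MeasurableSpace.comap Prod.snd inferInstance

/-- A coupling `γ`, viewed as the joint law of processes `X, Y`, is bicausal if for every
`t < N` and Borel `B ⊆ ℝ^t`, `ℙ((Y₁,…,Y_t) ∈ B | X₁,…,X_N) = ℙ((Y₁,…,Y_t) ∈ B | X₁,…,X_t)`
a.s. and symmetrically in `X` and `Y`. -/
def Bicausal (N : ℕ) (γ : Measure ((Fin N → ℝ) × (Fin N → ℝ))) : Prop :=
  ∀ (t : ℕ) (ht : t < N) (B : Set (Fin t → ℝ)), MeasurableSet B →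
    (γ[fun z => Set.indicator B (fun _ => (1 : ℝ)) (proj N t ht.le z.2) | sigmaXfull N]
      =ᵐ[γ]
     γ[fun z => Set.indicator B (fun _ => (1 : ℝ)) (proj N t ht.le z.2) | sigmaX N t ht.le]) ∧
    (γ[fun z => Set.indicator B (fun _ => (1 : ℝ)) (proj N t ht.le z.1) | sigmaYfull N]
      =ᵐ[γ]
     γ[fun z => Set.indicator B (fun _ => (1 : ℝ)) (proj N t ht.le z.1) | sigmaY N t ht.le])

/-- Projection of both components onto their first `t` coordinates. -/
def projPair (N t : ℕ) (ht : t ≤ N) (z : (Fin N → ℝ) × (Fin N → ℝ)) :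
    (Fin t → ℝ) × (Fin t → ℝ) :=
  (proj N t ht z.1, proj N t ht z.2)

section Auxiliary

variable {Ω α β δ : Type*} [MeasurableSpace Ω] [StandardBorelSpace Ω]
  [MeasurableSpace α] [MeasurableSpace β] [StandardBorelSpace β] [Nonempty β]
  [MeasurableSpace δ] [StandardBorelSpace δ] [Nonempty δ]
  {P : Measure Ω} [IsProbabilityMeasure P] {k : Ω → α} {f : Ω → β} {g : Ω → δ}

/-- Conditional independence of `g` and `f` given `k` means that conditioning events about `f` on
`(k, g)` is the same as conditioning them on `k`. -/
lemma condIndepFun_iff_forall_condExp_ae_eq (hf : Measurable f) (hg : Measurable g)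
    (hk : Measurable k) :
    g ⟂ᵢ[k, hk; P] f ↔ ∀ B : Set β, MeasurableSet B →
      P⟦f ⁻¹' B | MeasurableSpace.comap (fun ω => (k ω, g ω)) inferInstance⟧
        =ᵐ[P] P⟦f ⁻¹' B | MeasurableSpace.comap k inferInstance⟧ := by
  rw [condIndepFun_iff_condDistrib_prod_ae_eq_prodMkRight hf hg hk]
  have hkg : Measurable fun ω => (k ω, g ω) := hk.prodMk hg
  constructor
  · intro hae B hB
    filter_upwards [condDistrib_ae_eq_condExp hkg hf hB (μ := P),
      condDistrib_ae_eq_condExp hk hf hB (μ := P),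
      ae_of_ae_map hkg.aemeasurable hae] with ω h₁ h₂ h₃
    rw [← h₁, ← h₂, h₃, Kernel.prodMkRight_apply]
  · intro hcond
    rw [condDistrib_ae_eq_iff_measure_eq_compProd _ hf.aemeasurable,
      ← compProd_map_condDistrib hf.aemeasurable]
    refine Measure.ext_prod fun {s B} hs hB => ?_
    rw [Measure.compProd_apply_prod hs hB, Measure.compProd_apply_prod hs hB]
    refine lintegral_congr_ae (ae_restrict_of_ae ?_)
    refine (ae_map_iff hkg.aemeasurable (measurableSet_eq_fun (Kernel.measurable_coe _ hB)
      (Kernel.measurable_coe _ hB))).2 ?_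
    filter_upwards [condDistrib_ae_eq_condExp hkg hf hB (μ := P),
      condDistrib_ae_eq_condExp hk hf hB (μ := P), hcond B hB] with ω h₁ h₂ h₃
    rw [← h₁, ← h₂] at h₃
    rw [Kernel.prodMkRight_apply]
    exact (measureReal_eq_measureReal_iff (measure_ne_top _ _) (measure_ne_top _ _)).1 h₃

/-- If `κ` is the conditional law of `f` given `k` and `η` the conditional law of `f` given
`(k, g)`, then `g` and `f` are conditionally independent given `k` iff `η` and `κ` agree. -/
lemma condIndepFun_iff_kernel_ae_eq (hf : Measurable f) (hg : Measurable g) (hk : Measurable k)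
    {κ : Kernel α β} [IsFiniteKernel κ] {η : Kernel (α × δ) β} [IsFiniteKernel η]
    (hκ : P.map (fun ω => (k ω, f ω)) = P.map k ⊗ₘ κ)
    (hη : P.map (fun ω => ((k ω, g ω), f ω)) = P.map (fun ω => (k ω, g ω)) ⊗ₘ η) :
    g ⟂ᵢ[k, hk; P] f ↔ ∀ᵐ w ∂P.map (fun ω => (k ω, g ω)), η w = κ w.1 := by
  rw [condIndepFun_iff_condDistrib_prod_ae_eq_prodMkRight hf hg hk]
  have hη' := condDistrib_ae_eq_of_measure_eq_compProd _ hf.aemeasurable hη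
  have hκ' : ∀ᵐ w ∂P.map (fun ω => (k ω, g ω)), condDistrib f k P w.1 = κ w.1 := by
    have hfst : (P.map (fun ω => (k ω, g ω))).map Prod.fst = P.map k := by
      rw [Measure.map_map measurable_fst (hk.prodMk hg)]; rfl
    refine ae_of_ae_map measurable_fst.aemeasurable (p := fun u => condDistrib f k P u = κ u) ?_
    rw [hfst]
    exact condDistrib_ae_eq_of_measure_eq_compProd _ hf.aemeasurable hκ
  constructor <;> intro hae <;> filter_upwards [hae, hη', hκ'] with w h₁ h₂ h₃
  · rw [← h₂, h₁, Kernel.prodMkRight_apply, h₃]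
  · rw [h₂, h₁, Kernel.prodMkRight_apply, h₃]

end Auxiliary

/-- Swapping the conditioning variables in a composition-product. -/
lemma map_swap_compProd {α β δ : Type*} [MeasurableSpace α] [MeasurableSpace β]
    [MeasurableSpace δ] (m : Measure (α × β)) [IsFiniteMeasure m] (κ : Kernel (α × β) δ)
    [IsFiniteKernel κ] :
    (m ⊗ₘ κ).map (Prod.map Prod.swap id)
      = m.map Prod.swap ⊗ₘ κ.comap Prod.swap measurable_swap := by
  refine Measure.ext_prod fun {s t} hs ht => ?_
  rw [Measure.map_apply (by fun_prop) (hs.prod ht), Measure.compProd_apply_prod hs ht,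
    setLIntegral_map hs (Kernel.measurable_coe _ ht) measurable_swap,
    Set.preimage_prod_map_prod, Set.preimage_id,
    Measure.compProd_apply_prod (measurable_swap hs) ht]
  simp [Kernel.comap_apply]

section Projection

variable {N t : ℕ}

lemma measurable_proj (ht : t ≤ N) : Measurable (proj N t ht) :=
  measurable_pi_lambda _ fun _ => measurable_pi_apply _

lemma measurable_projPair (ht : t ≤ N) : Measurable (projPair N t ht) :=
  ((measurable_proj ht).comp measurable_fst).prodMk ((measurable_proj ht).comp measurable_snd)

lemma measurable_finSnoc :
    Measurable fun q : (Fin t → ℝ) × ℝ => (Fin.snoc q.1 q.2 : Fin (t + 1) → ℝ) := by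
  refine measurable_pi_lambda _ fun i => ?_
  induction i using Fin.lastCases with
  | last => simpa using measurable_snd
  | cast i => simpa [Function.comp_def] using (measurable_pi_apply i).comp measurable_fst

lemma measurable_finInit :
    Measurable fun x : Fin (t + 1) → ℝ => (Fin.init x : Fin t → ℝ) :=
  measurable_pi_lambda _ fun _ => measurable_pi_apply _

lemma snoc_proj (ht : t < N) (x : Fin N → ℝ) :
    (Fin.snoc (proj N t ht.le x) (x ⟨t, ht⟩) : Fin (t + 1) → ℝ) = proj N (t + 1) ht x := by
  ext i
  induction i using Fin.lastCases with
  | last => rw [Fin.snoc_last]; rfl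
  | cast i => simp [proj]

lemma comap_proj_mono {Ω : Type*} (X : Ω → Fin N → ℝ) {s : ℕ} (hts : t ≤ s) (hs : s ≤ N) :
    MeasurableSpace.comap (fun ω => proj N t (hts.trans hs) (X ω)) inferInstance ≤
      MeasurableSpace.comap (fun ω => proj N s hs (X ω)) inferInstance := by
  rw [show (fun ω => proj N t (hts.trans hs) (X ω)) =
    proj s t hts ∘ fun ω => proj N s hs (X ω) from rfl, ← MeasurableSpace.comap_comp]
  exact MeasurableSpace.comap_mono (measurable_proj hts).comap_le

lemma comap_proj_self {Ω : Type*} (X : Ω → Fin N → ℝ) :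
    MeasurableSpace.comap (fun ω => proj N N le_rfl (X ω)) inferInstance =
      MeasurableSpace.comap X inferInstance := rfl

lemma comap_proj_succ {Ω : Type*} (X : Ω → Fin N → ℝ) (ht : t < N) :
    MeasurableSpace.comap (fun ω => (proj N t ht.le (X ω), X ω ⟨t, ht⟩)) inferInstance =
      MeasurableSpace.comap (fun ω => proj N (t + 1) ht (X ω)) inferInstance := by
  apply le_antisymm
  · rw [show (fun ω => (proj N t ht.le (X ω), X ω ⟨t, ht⟩)) =
      (fun x : Fin (t + 1) → ℝ => ((Fin.init x : Fin t → ℝ), x (Fin.last t))) ∘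
        fun ω => proj N (t + 1) ht (X ω) from rfl, ← MeasurableSpace.comap_comp]
    exact MeasurableSpace.comap_mono
      (measurable_finInit.prodMk (measurable_pi_apply _)).comap_le
  · simp_rw [← snoc_proj ht]
    rw [show (fun ω => (Fin.snoc (proj N t ht.le (X ω)) (X ω ⟨t, ht⟩) : Fin (t + 1) → ℝ)) =
      (fun q : (Fin t → ℝ) × ℝ => (Fin.snoc q.1 q.2 : Fin (t + 1) → ℝ)) ∘
        fun ω => (proj N t ht.le (X ω), X ω ⟨t, ht⟩) from rfl, ← MeasurableSpace.comap_comp]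
    exact MeasurableSpace.comap_mono measurable_finSnoc.comap_le

end Projection

/-- Causality from `X` to `Y` holds iff at every time `t` the next value of `X` is independent of
the past of `Y` given the past of `X`. -/
lemma causal_iff_condIndepFun {Ω : Type*} [MeasurableSpace Ω] [StandardBorelSpace Ω]
    {P : Measure Ω} [IsProbabilityMeasure P] {N : ℕ} {X Y : Ω → Fin N → ℝ}
    (hX : Measurable X) (hY : Measurable Y) :
    (∀ (t : ℕ) (ht : t < N) (B : Set (Fin t → ℝ)), MeasurableSet B →
      P⟦(fun ω => proj N t ht.le (Y ω)) ⁻¹' B | MeasurableSpace.comap X inferInstance⟧ =ᵐ[P]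
        P⟦(fun ω => proj N t ht.le (Y ω)) ⁻¹' B |
          MeasurableSpace.comap (fun ω => proj N t ht.le (X ω)) inferInstance⟧) ↔
      ∀ (t : ℕ) (ht : t < N), (fun ω => proj N t ht.le (Y ω))
        ⟂ᵢ[fun ω => proj N t ht.le (X ω), (measurable_proj ht.le).comp hX; P]
          (fun ω => X ω ⟨t, ht⟩) := by
  have hpX (t : ℕ) (ht : t ≤ N) : Measurable fun ω => proj N t ht (X ω) :=
    (measurable_proj ht).comp hX
  have hpY (t : ℕ) (ht : t ≤ N) : Measurable fun ω => proj N t ht (Y ω) :=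
    (measurable_proj ht).comp hY
  have hstep (t : ℕ) (ht : t < N) : ((fun ω => proj N t ht.le (Y ω))
        ⟂ᵢ[fun ω => proj N t ht.le (X ω), (measurable_proj ht.le).comp hX; P]
          (fun ω => X ω ⟨t, ht⟩)) ↔ ∀ B : Set (Fin t → ℝ), MeasurableSet B →
      P⟦(fun ω => proj N t ht.le (Y ω)) ⁻¹' B |
          MeasurableSpace.comap (fun ω => proj N (t + 1) ht (X ω)) inferInstance⟧ =ᵐ[P]
        P⟦(fun ω => proj N t ht.le (Y ω)) ⁻¹' B |
          MeasurableSpace.comap (fun ω => proj N t ht.le (X ω)) inferInstance⟧ := by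
    have hXt : Measurable fun ω => X ω ⟨t, ht⟩ := (measurable_pi_apply _).comp hX
    rw [← comap_proj_succ X ht,
      ← condIndepFun_iff_forall_condExp_ae_eq (hpY t ht.le) hXt (hpX t ht.le)]
    exact ⟨CondIndepFun.symm, CondIndepFun.symm⟩
  constructor
  · intro hc t ht
    rw [hstep]
    intro B hB
    have hle := comap_proj_mono X ht le_rfl
    rw [comap_proj_self] at hle
    have h₁ := condExp_condExp_of_le (μ := P)
      (f := ((fun ω => proj N t ht.le (Y ω)) ⁻¹' B).indicator fun _ => (1 : ℝ)) hle hX.comap_le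
    have h₂ : P[P⟦(fun ω => proj N t ht.le (Y ω)) ⁻¹' B |
          MeasurableSpace.comap (fun ω => proj N t ht.le (X ω)) inferInstance⟧ |
          MeasurableSpace.comap (fun ω => proj N (t + 1) ht (X ω)) inferInstance] =
        P⟦(fun ω => proj N t ht.le (Y ω)) ⁻¹' B |
          MeasurableSpace.comap (fun ω => proj N t ht.le (X ω)) inferInstance⟧ :=
      condExp_of_stronglyMeasurable (hpX _ ht).comap_le
        (stronglyMeasurable_condExp.mono (comap_proj_mono X t.le_succ ht)) integrable_condExp
    rw [← h₂]
    exact h₁.symm.trans (condExp_congr_ae (hc t ht B hB))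
  · intro hi t ht B hB
    have key : ∀ s (hs : s ≤ N), t ≤ s →
        P⟦(fun ω => proj N t ht.le (Y ω)) ⁻¹' B |
          MeasurableSpace.comap (fun ω => proj N s hs (X ω)) inferInstance⟧ =ᵐ[P]
        P⟦(fun ω => proj N t ht.le (Y ω)) ⁻¹' B |
          MeasurableSpace.comap (fun ω => proj N t ht.le (X ω)) inferInstance⟧ := by
      intro s hs hts
      induction s, hts using Nat.le_induction with
      | base => rfl
      | succ s hts ih =>
        exact ((hstep s hs).1 (hi s hs) (proj s t hts ⁻¹' B) (measurable_proj hts hB)).trans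
          (ih (Nat.le_of_succ_le hs))
    exact key N le_rfl ht.le

/-- If `κ t` is the conditional law of `X_{t+1}` given the past of `X`, and `η t` the one given the
pasts of `X` and `Y`, then causality from `X` to `Y` means that `η t` and `κ t` agree. -/
lemma causal_iff_kernel_ae_eq {Ω : Type*} [MeasurableSpace Ω] [StandardBorelSpace Ω]
    {P : Measure Ω} [IsProbabilityMeasure P] {N : ℕ} {X Y : Ω → Fin N → ℝ}
    (hX : Measurable X) (hY : Measurable Y)
    {κ : (t : ℕ) → Kernel (Fin t → ℝ) ℝ} [∀ t, IsFiniteKernel (κ t)]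
    {η : (t : ℕ) → Kernel ((Fin t → ℝ) × (Fin t → ℝ)) ℝ} [∀ t, IsFiniteKernel (η t)]
    (hκ : ∀ (t : ℕ) (ht : t < N), P.map (fun ω => (proj N t ht.le (X ω), X ω ⟨t, ht⟩)) =
      P.map (fun ω => proj N t ht.le (X ω)) ⊗ₘ κ t)
    (hη : ∀ (t : ℕ) (ht : t < N),
      P.map (fun ω => ((proj N t ht.le (X ω), proj N t ht.le (Y ω)), X ω ⟨t, ht⟩)) =
        P.map (fun ω => (proj N t ht.le (X ω), proj N t ht.le (Y ω))) ⊗ₘ η t) :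
    (∀ (t : ℕ) (ht : t < N) (B : Set (Fin t → ℝ)), MeasurableSet B →
      P⟦(fun ω => proj N t ht.le (Y ω)) ⁻¹' B | MeasurableSpace.comap X inferInstance⟧ =ᵐ[P]
        P⟦(fun ω => proj N t ht.le (Y ω)) ⁻¹' B |
          MeasurableSpace.comap (fun ω => proj N t ht.le (X ω)) inferInstance⟧) ↔
      ∀ (t : ℕ) (ht : t < N),
        ∀ᵐ w ∂P.map (fun ω => (proj N t ht.le (X ω), proj N t ht.le (Y ω))), η t w = κ t w.1 := by
  rw [causal_iff_condIndepFun hX hY]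
  refine forall₂_congr fun t ht => ?_
  exact condIndepFun_iff_kernel_ae_eq ((measurable_pi_apply _).comp hX)
    ((measurable_proj ht.le).comp hY) ((measurable_proj ht.le).comp hX) (hκ t ht) (hη t ht)

/-- A disintegration of the law of the first `t + 1` coordinates, read on pairs. -/
lemma map_proj_prodMk_eq_compProd {N t : ℕ} (ht : t < N) {m : Measure (Fin N → ℝ)}
    {κ : Kernel (Fin t → ℝ) ℝ}
    (h : m.map (proj N (t + 1) ht) =
      (m.map (proj N t ht.le) ⊗ₘ κ).map (fun q => Fin.snoc q.1 q.2)) :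
    m.map (fun x => (proj N t ht.le x, x ⟨t, ht⟩)) = m.map (proj N t ht.le) ⊗ₘ κ := by
  have hφ : Measurable fun x : Fin (t + 1) → ℝ => ((Fin.init x : Fin t → ℝ), x (Fin.last t)) :=
    measurable_finInit.prodMk (measurable_pi_apply _)
  have h' := congrArg (Measure.map
    fun x : Fin (t + 1) → ℝ => ((Fin.init x : Fin t → ℝ), x (Fin.last t))) h
  rw [Measure.map_map hφ (measurable_proj ht), Measure.map_map hφ measurable_finSnoc] at h'
  simp only [Function.comp_def, Fin.init_snoc, Fin.snoc_last] at h'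
  exact h'.trans Measure.map_id

/-- A disintegration of the joint law of the first `t + 1` coordinates of two processes, read on
pairs. -/
lemma map_projPair_prodMk_eq_compProd {N t : ℕ} (ht : t < N)
    {γ : Measure ((Fin N → ℝ) × (Fin N → ℝ))}
    {κ : Kernel ((Fin t → ℝ) × (Fin t → ℝ)) (ℝ × ℝ)}
    (h : γ.map (projPair N (t + 1) ht) = (γ.map (projPair N t ht.le) ⊗ₘ κ).map
      (fun q => (Fin.snoc q.1.1 q.2.1, Fin.snoc q.1.2 q.2.2))) :
    γ.map (fun z => (projPair N t ht.le z, (z.1 ⟨t, ht⟩, z.2 ⟨t, ht⟩))) =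
      γ.map (projPair N t ht.le) ⊗ₘ κ := by
  have hφ : Measurable fun x : (Fin (t + 1) → ℝ) × (Fin (t + 1) → ℝ) =>
      (((Fin.init x.1 : Fin t → ℝ), (Fin.init x.2 : Fin t → ℝ)),
        (x.1 (Fin.last t), x.2 (Fin.last t))) :=
    ((measurable_finInit.comp measurable_fst).prodMk
      (measurable_finInit.comp measurable_snd)).prodMk (by fun_prop)
  have h' := congrArg (Measure.map fun x : (Fin (t + 1) → ℝ) × (Fin (t + 1) → ℝ) =>
      (((Fin.init x.1 : Fin t → ℝ), (Fin.init x.2 : Fin t → ℝ)),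
        (x.1 (Fin.last t), x.2 (Fin.last t)))) h
  have hψ : Measurable fun q : ((Fin t → ℝ) × (Fin t → ℝ)) × (ℝ × ℝ) =>
      ((Fin.snoc q.1.1 q.2.1 : Fin (t + 1) → ℝ), (Fin.snoc q.1.2 q.2.2 : Fin (t + 1) → ℝ)) :=
    (measurable_finSnoc.comp ((measurable_fst.comp measurable_fst).prodMk
      (measurable_fst.comp measurable_snd))).prodMk
    (measurable_finSnoc.comp ((measurable_snd.comp measurable_fst).prodMk
      (measurable_snd.comp measurable_snd)))
  rw [Measure.map_map hφ (measurable_projPair ht), Measure.map_map hφ hψ] at h'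
  simp only [Function.comp_def, Fin.init_snoc, Fin.snoc_last] at h'
  exact h'.trans Measure.map_id

/-- a coupling `γ` of `μ` and `ν` is bicausal if and only if, in the successive
disintegration of `γ` by kernels `γK t` (whose counterparts for `μ` and `ν` are the kernels
`μK t` and `νK t`), the first-stage coupling `γ̄` lies in `Π(μ₁,ν₁)` and for every `t < N` and
`γ`-almost every `(x₁,…,x_t,y₁,…,y_t)` the marginals of `γK t (x,y)` are `μK t x` and
`νK t y`. -/
theorem bicausal_iff_disintegration (N : ℕ) (hN : 1 ≤ N)
    (μ ν : Measure (Fin N → ℝ)) [IsProbabilityMeasure μ] [IsProbabilityMeasure ν]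
    (γ : Measure ((Fin N → ℝ) × (Fin N → ℝ))) (hγ : γ ∈ coupling μ ν)
    (μK νK : (t : ℕ) → Kernel (Fin t → ℝ) ℝ)
    (γK : (t : ℕ) → Kernel ((Fin t → ℝ) × (Fin t → ℝ)) (ℝ × ℝ))
    (hμKm : ∀ t, IsMarkovKernel (μK t)) (hνKm : ∀ t, IsMarkovKernel (νK t))
    (hγKm : ∀ t, IsMarkovKernel (γK t))
    (hμK : ∀ (t : ℕ) (ht : t < N),
      μ.map (proj N (t + 1) ht) =
        ((μ.map (proj N t ht.le)).compProd (μK t)).map (fun q => Fin.snoc q.1 q.2))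
    (hνK : ∀ (t : ℕ) (ht : t < N),
      ν.map (proj N (t + 1) ht) =
        ((ν.map (proj N t ht.le)).compProd (νK t)).map (fun q => Fin.snoc q.1 q.2))
    (hγK : ∀ (t : ℕ) (ht : t < N),
      γ.map (projPair N (t + 1) ht) =
        ((γ.map (projPair N t ht.le)).compProd (γK t)).map
          (fun q => (Fin.snoc q.1.1 q.2.1, Fin.snoc q.1.2 q.2.2))) :
    Bicausal N γ ↔
      ((γ.map (fun z => (z.1 ⟨0, hN⟩, z.2 ⟨0, hN⟩)) ∈
          coupling (μ.map (fun x => x ⟨0, hN⟩)) (ν.map (fun x => x ⟨0, hN⟩))) ∧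
        ∀ (t : ℕ) (ht : t < N),
          ∀ᵐ w ∂(γ.map (projPair N t ht.le)),
            (γK t w).map Prod.fst = μK t w.1 ∧ (γK t w).map Prod.snd = νK t w.2) := by
  have hγfst : γ.map Prod.fst = μ := hγ.1
  have hγsnd : γ.map Prod.snd = ν := hγ.2
  have : IsProbabilityMeasure γ := by
    rw [← Measure.isProbabilityMeasure_map_iff (f := Prod.fst) measurable_fst.aemeasurable, hγfst]
    infer_instance
  have hpair (t : ℕ) (ht : t < N) := map_projPair_prodMk_eq_compProd ht (hγK t ht)
  have hpm (t : ℕ) (ht : t < N) : Measurable fun z : (Fin N → ℝ) × (Fin N → ℝ) =>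
      (projPair N t ht.le z, (z.1 ⟨t, ht⟩, z.2 ⟨t, ht⟩)) :=
    (measurable_projPair ht.le).prodMk (by fun_prop)
  have hXY := causal_iff_kernel_ae_eq (P := γ) (κ := μK) (η := fun t => (γK t).map Prod.fst)
    measurable_fst measurable_snd
    (fun t ht => by
      have h := map_proj_prodMk_eq_compProd ht (hμK t ht)
      rwa [← hγfst, Measure.map_map ((measurable_proj ht.le).prodMk (measurable_pi_apply _))
        measurable_fst, Measure.map_map (measurable_proj ht.le) measurable_fst] at h)
    (fun t ht => by
      rw [Measure.compProd_map measurable_fst]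
      exact (Measure.map_map (by fun_prop) (hpm t ht)).symm.trans
        (congrArg (Measure.map (Prod.map id Prod.fst)) (hpair t ht)))
  have hYX := causal_iff_kernel_ae_eq (P := γ) (κ := νK)
    (η := fun t => ((γK t).map Prod.snd).comap Prod.swap measurable_swap)
    measurable_snd measurable_fst
    (fun t ht => by
      have h := map_proj_prodMk_eq_compProd ht (hνK t ht)
      rwa [← hγsnd, Measure.map_map ((measurable_proj ht.le).prodMk (measurable_pi_apply _))
        measurable_snd, Measure.map_map (measurable_proj ht.le) measurable_snd] at h)
    (fun t ht => by
      have hswap : γ.map (fun z => (proj N t ht.le z.2, proj N t ht.le z.1)) =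
          (γ.map (projPair N t ht.le)).map Prod.swap :=
        (Measure.map_map measurable_swap (measurable_projPair ht.le)).symm
      rw [hswap, ← map_swap_compProd, Measure.compProd_map measurable_snd, ← hpair t ht,
        Measure.map_map (by fun_prop) (hpm t ht), Measure.map_map (by fun_prop)
          ((measurable_id.prodMap measurable_snd).comp (hpm t ht))]
      rfl)
  have hbic : Bicausal N γ ↔
      (∀ (t : ℕ) (ht : t < N), ∀ᵐ w ∂(γ.map (projPair N t ht.le)),
        (γK t w).map Prod.fst = μK t w.1) ∧
      (∀ (t : ℕ) (ht : t < N), ∀ᵐ w ∂(γ.map (projPair N t ht.le)),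
        (γK t w).map Prod.snd = νK t w.2) := by
    have hsplit : Bicausal N γ ↔ _ ∧ _ :=
      ⟨fun h => ⟨fun t ht B hB => (h t ht B hB).1, fun t ht B hB => (h t ht B hB).2⟩,
        fun h t ht B hB => ⟨h.1 t ht B hB, h.2 t ht B hB⟩⟩
    refine hsplit.trans (and_congr (hXY.trans ?_) (hYX.trans ?_))
    · refine forall₂_congr fun t ht => ?_
      simp only [Kernel.map_apply _ measurable_fst]
      rfl
    · refine forall₂_congr fun t ht => ?_
      have hswap : γ.map (fun z => (proj N t ht.le z.2, proj N t ht.le z.1)) =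
          (γ.map (projPair N t ht.le)).map Prod.swap :=
        (Measure.map_map measurable_swap (measurable_projPair ht.le)).symm
      rw [hswap, MeasurableEquiv.prodComm.measurableEmbedding.ae_map_iff (f := Prod.swap)]
      simp only [Kernel.comap_apply, Kernel.map_apply _ measurable_snd, Prod.swap_swap,
        Prod.fst_swap]
  have hfirst : γ.map (fun z => (z.1 ⟨0, hN⟩, z.2 ⟨0, hN⟩)) ∈
      coupling (μ.map (fun x => x ⟨0, hN⟩)) (ν.map (fun x => x ⟨0, hN⟩)) := by
    constructor
    · rw [← hγfst, Measure.map_map (by fun_prop) (by fun_prop),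
        Measure.map_map (by fun_prop) (by fun_prop)]
      rfl
    · rw [← hγsnd, Measure.map_map (by fun_prop) (by fun_prop),
        Measure.map_map (by fun_prop) (by fun_prop)]
      rfl
  rw [hbic, and_iff_right hfirst]
  simp only [eventually_and, forall_and]
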